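/- arXiv:1901.02307 — 2 statements merged into one kernel-verified Lean document; each statement's English description precedes it below -/
import Mathlib

section
/- Let k ≥ 1 and let l, u : Fin k → ℝ satisfy l p ≤ u p for every p, and u p < l q whenever p < q (the intervals are ordered and pairwise disjoint). Then for every real number d: d belongs to the union ⋃ p, [l p, u p] if and only if l 0 ≤ d, d ≤ u (k-1), and for every p with p + 1 < k, either d ≤ u p or l (p+1) ≤ d. -/
/-- Rewriting membership in an ordered disjoint union of closed intervals
`[l 0, u 0] ∪ ... ∪ [l (k-1), u (k-1)]` as a conjunction of two-way
disjunctions of linear inequalities. -/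
theorem simple_disjunction_rewrite (k : ℕ) (hk : 1 ≤ k) (l u : Fin k → ℝ)
    (hlu : ∀ p, l p ≤ u p) (hord : ∀ p q : Fin k, p < q → u p < l q) (d : ℝ) :
    d ∈ ⋃ p : Fin k, Set.Icc (l p) (u p) ↔
      l ⟨0, hk⟩ ≤ d ∧ d ≤ u ⟨k - 1, by omega⟩ ∧
        ∀ p : Fin k, ∀ h : p.val + 1 < k, d ≤ u p ∨ l ⟨p.val + 1, h⟩ ≤ d := by
  have hl : Monotone l := fun p q hpq => by
    rcases hpq.eq_or_lt with rfl | h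
    · exact le_rfl
    · exact (hlu p).trans (hord p q h).le
  have hu : Monotone u := fun p q hpq => by
    rcases hpq.eq_or_lt with rfl | h
    · exact le_rfl
    · exact (hord p q h).le.trans (hlu q)
  simp only [Set.mem_iUnion, Set.mem_Icc]
  constructor
  · rintro ⟨p, hlp, hup⟩
    refine ⟨(hl (Fin.mk_le_of_le_val (Nat.zero_le _))).trans hlp,
      hup.trans (hu (Fin.le_def.2 (Nat.le_sub_one_of_lt p.isLt))), fun q hq => ?_⟩
    rcases le_or_gt p q with h | h
    · exact Or.inl (hup.trans (hu h))
    · exact Or.inr ((hl (Fin.le_def.2 (Nat.succ_le_of_lt h))).trans hlp)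
  · rintro ⟨h_first, h_last, h_gap⟩
    by_contra! h_not_mem
    have h_lower : ∀ n (hn : n < k), l ⟨n, hn⟩ ≤ d := by
      intro n
      induction n with
      | zero => exact fun _ => h_first
      | succ n ih =>
        intro hn
        have hn' : n < k := Nat.lt_of_succ_lt hn
        exact (h_gap ⟨n, hn'⟩ hn).resolve_left (h_not_mem _ (ih hn')).not_ge
    exact (h_not_mem _ (h_lower (k - 1) (by omega))).not_ge h_last
end

section
/- Let g1, g2, g3 ∈ ({0, 1} : Set ℤ). Then the following are equivalent: (a) there exist a1, a2, a3, a4, a5, a6 ∈ ({0, 1, 2} : Set ℤ) with a1 ≠ g1, a2 ≠ g2, a1 ≠ a2, a3 ≠ a1, a3 ≠ a2, a4 ≠ a3, a5 ≠ g3, a4 ≠ a5, a6 ≠ a4, a6 ≠ a5, and a6 = 1; (b) g1 = 1 ∨ g2 = 1 ∨ g3 = 1. -/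
/-- Correctness of the two-level or-gadget used in the Π₂ᵖ-hardness proof for
WC-TCSPU: the internal timepoints can be assigned (with the output equal to 1)
precisely when at least one input literal is true. -/
theorem or_gadget_correct (g1 g2 g3 : ℤ)
    (hg1 : g1 ∈ ({0, 1} : Set ℤ)) (hg2 : g2 ∈ ({0, 1} : Set ℤ))
    (hg3 : g3 ∈ ({0, 1} : Set ℤ)) :
    (∃ a1 a2 a3 a4 a5 a6 : ℤ,
        a1 ∈ ({0, 1, 2} : Set ℤ) ∧ a2 ∈ ({0, 1, 2} : Set ℤ) ∧
        a3 ∈ ({0, 1, 2} : Set ℤ) ∧ a4 ∈ ({0, 1, 2} : Set ℤ) ∧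
        a5 ∈ ({0, 1, 2} : Set ℤ) ∧ a6 ∈ ({0, 1, 2} : Set ℤ) ∧
        a1 ≠ g1 ∧ a2 ≠ g2 ∧ a1 ≠ a2 ∧ a3 ≠ a1 ∧ a3 ≠ a2 ∧
        a4 ≠ a3 ∧ a5 ≠ g3 ∧ a4 ≠ a5 ∧ a6 ≠ a4 ∧ a6 ≠ a5 ∧ a6 = 1) ↔
      (g1 = 1 ∨ g2 = 1 ∨ g3 = 1) := by
  simp only [Set.mem_insert_iff, Set.mem_singleton_iff] at *
  constructor
  · rintro ⟨a1, a2, a3, a4, a5, a6, h1, h2, h3, h4, h5, -, n1, n2, n12, n31, n32, n43, n5, n45,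
      n64, n65, rfl⟩
    by_contra! hg
    obtain rfl : g1 = 0 := hg1.resolve_right hg.1
    obtain rfl : g2 = 0 := hg2.resolve_right hg.2.1
    obtain rfl : g3 = 0 := hg3.resolve_right hg.2.2
    have a3_eq : a3 = 0 := by
      clear h4 h5 n43 n5 n45 n64 n65
      omega
    have a5_eq : a5 = 2 := by
      clear h1 h2 h3 h4 n1 n2 n12 n31 n32 n43 n45 n64
      omega
    clear h1 h2 h3 h5 n1 n2 n12 n31 n32 n5 n65
    omega
  · intro h
    rcases hg1 with rfl | rfl <;> rcases hg2 with rfl | rfl <;> rcases hg3 with rfl | rfl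
    · simp at h
    · exact ⟨1, 2, 0, 2, 0, 1, by norm_num⟩
    · exact ⟨2, 0, 1, 0, 2, 1, by norm_num⟩
    · exact ⟨2, 0, 1, 2, 0, 1, by norm_num⟩
    · exact ⟨0, 2, 1, 0, 2, 1, by norm_num⟩
    · exact ⟨0, 2, 1, 2, 0, 1, by norm_num⟩
    · exact ⟨0, 2, 1, 0, 2, 1, by norm_num⟩
    · exact ⟨0, 2, 1, 2, 0, 1, by norm_num⟩
end
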